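/- Suppose that whenever Ω* ∩ argmin_{x∈A} F(x,λ*,c) ≠ ∅ and min_{x∈A} F(x,λ*,c) = f* for some λ* ∈ Λ and c > 0, the function F is strictly globally parametrically exact with λ* a strictly exact tuning parameter. Suppose also that Ω is closed and f is lower semicontinuous on Ω. Then F is strictly globally parametrically exact if and only if there exists λ* ∈ Λ such that: (1) F is of penalty-type and non-degenerate for λ = λ*; (2) F is locally parametrically exact at every globally optimal solution of (P) with exact tuning parameter λ*; and (3) there exists c₀ > 0 such that F(x*,λ*,c) = f* for all x* ∈ Ω* and all c ≥ c₀. -/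

import Mathlib

open Set Filter Topology

/-- The set of global minimizers of `g` on the set `A`. -/
def minimizersOn {X : Type*} (g : X → EReal) (A : Set X) : Set X :=
  {x ∈ A | ∀ y ∈ A, g x ≤ g y}

/-- The set of globally optimal solutions of the problem (P):
minimize `f x` subject to `x ∈ M`, `x ∈ A`. -/
def optSet {X : Type*} (f : X → EReal) (M A : Set X) : Set X :=
  minimizersOn f (M ∩ A)

/-- `F` is globally parametrically exact with exact tuning parameter `lam`. -/
def GloballyParamExact {X Λ : Type*} (f : X → EReal) (M A : Set X)
    (F : X → Λ → ℝ → EReal) (lam : Λ) : Prop :=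
  ∃ cs > (0 : ℝ), ∀ c ≥ cs, minimizersOn (fun x => F x lam c) A = optSet f M A

/-- `F` is locally parametrically exact at `x₀` with exact tuning parameter `lam`. -/
def LocallyParamExact {X Λ : Type*} [TopologicalSpace X] (A : Set X)
    (F : X → Λ → ℝ → EReal) (lam : Λ) (x₀ : X) : Prop :=
  ∃ cs > (0 : ℝ), ∃ U ∈ 𝓝 x₀, ∀ c ≥ cs, ∀ x ∈ U ∩ A, F x₀ lam c ≤ F x lam c

/-- `F` is a penalty-type separating function for `λ = lam`. -/
def PenaltyType {X Λ : Type*} [TopologicalSpace X] (f : X → EReal) (M A : Set X)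
    (F : X → Λ → ℝ → EReal) (lam : Λ) : Prop :=
  ∃ c₀ > (0 : ℝ), ∀ cseq : ℕ → ℝ, StrictMono cseq → (∀ n, c₀ ≤ cseq n) →
    Tendsto cseq atTop atTop →
    ∀ xseq : ℕ → X, (∀ n, xseq n ∈ minimizersOn (fun x => F x lam (cseq n)) A) →
    ∀ x₀ : X, MapClusterPt x₀ atTop xseq → x₀ ∈ optSet f M A

/-- `F` is non-degenerate for `λ = lam`. -/
def NonDegenerate {X Λ : Type*} [NormedAddCommGroup X] (A : Set X)
    (F : X → Λ → ℝ → EReal) (lam : Λ) : Prop :=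
  ∃ c₀ > (0 : ℝ), ∃ R > (0 : ℝ), ∀ c ≥ c₀,
    ∃ x ∈ minimizersOn (fun y => F y lam c) A, ‖x‖ ≤ R

/-- `F` is strictly globally parametrically exact with strictly exact tuning
parameter `lam`: it is globally parametrically exact with exact tuning parameter `lam`
and for all sufficiently large `c` the infimum of `F (·, lam, c)` over `A` equals the
optimal value `f* = inf_{x ∈ Ω} f x` of the problem (P). -/
def StrictGloballyParamExact {X Λ : Type*} (f : X → EReal) (M A : Set X)
    (F : X → Λ → ℝ → EReal) (lam : Λ) : Prop :=
  GloballyParamExact f M A F lam ∧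
  ∃ c₀ > (0 : ℝ), ∀ c ≥ c₀,
    sInf ((fun x => F x lam c) '' A) = sInf (f '' (M ∩ A))

theorem sInf_image_eq_of_mem_minimizersOn {X : Type*} {g : X → EReal} {A : Set X} {x : X}
    (hx : x ∈ minimizersOn g A) : sInf (g '' A) = g x :=
  le_antisymm (sInf_le ⟨x, hx.1, rfl⟩) (le_sInf (by rintro _ ⟨y, hy, rfl⟩; exact hx.2 y hy))

/-- The minimizers of a lower semicontinuous function on a closed set form a closed set. -/
theorem LowerSemicontinuousOn.isClosed_minimizersOn {X : Type*} [TopologicalSpace X]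
    {g : X → EReal} {S : Set X} (hg : LowerSemicontinuousOn g S) (hS : IsClosed S) :
    IsClosed (minimizersOn g S) := by
  rw [isClosed_iff_frequently]
  intro x hx
  have hxS : x ∈ S := isClosed_iff_frequently.1 hS x (hx.mono fun _ h => h.1)
  refine ⟨hxS, fun y hy => ?_⟩
  by_contra! h
  have hev := eventually_nhdsWithin_iff.1 (hg x hxS (g y) h)
  obtain ⟨z, hz, hz'⟩ := (hx.and_eventually hev).exists
  exact absurd (hz.2 y hy) (not_le.2 (hz' hz.1))

/-- Strengthened Localization Principle in the Parametric Form I. -/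
theorem strengthened_localization_principle_parametric_I
    {X : Type*} [NormedAddCommGroup X] [NormedSpace ℝ X] [FiniteDimensional ℝ X]
    {Λ : Type*} [Nonempty Λ]
    (f : X → EReal) (M A : Set X) (F : X → Λ → ℝ → EReal)
    (hM : M.Nonempty) (hA : A.Nonempty)
    (hfeas : ∃ x ∈ M ∩ A, f x < ⊤)
    (hopt : (optSet f M A).Nonempty)
    (hkey : ∀ lam : Λ, ∀ c > (0 : ℝ),
      (optSet f M A ∩ minimizersOn (fun x => F x lam c) A).Nonempty →
      sInf ((fun x => F x lam c) '' A) = sInf (f '' (M ∩ A)) →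
      StrictGloballyParamExact f M A F lam)
    (hΩ : IsClosed (M ∩ A))
    (hf : LowerSemicontinuousOn f (M ∩ A)) :
    (∃ lam : Λ, StrictGloballyParamExact f M A F lam) ↔
      ∃ lam : Λ,
        (PenaltyType f M A F lam ∧ NonDegenerate A F lam) ∧
        (∀ x₀ ∈ optSet f M A, LocallyParamExact A F lam x₀) ∧
        (∃ c₀ > (0 : ℝ), ∀ xs ∈ optSet f M A, ∀ c ≥ c₀,
          F xs lam c = sInf (f '' (M ∩ A))) := by
  constructor
  · rintro ⟨lam, ⟨cs, hcs, hmin⟩, c₀, hc₀, hinf⟩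
    obtain ⟨z, hz⟩ := hopt
    refine ⟨lam, ⟨⟨cs, hcs, ?_⟩, ⟨cs, hcs, ‖z‖ + 1, by positivity, ?_⟩⟩, ?_,
      max cs c₀, lt_max_of_lt_left hcs, ?_⟩
    · intro cseq _ hge _ xseq hx x₀ hcl
      refine isClosed_iff_frequently.1 (hf.isClosed_minimizersOn hΩ) x₀ ?_
      refine Filter.frequently_iff.2 fun {U} hU => ?_
      obtain ⟨n, hn⟩ := (hcl.frequently hU).exists
      exact ⟨xseq n, hn, by have := hx n; rwa [hmin _ (hge n)] at this⟩
    · intro c hc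
      exact ⟨z, by rwa [hmin c hc], by linarith⟩
    · intro x₀ hx₀
      refine ⟨cs, hcs, univ, univ_mem, fun c hc x hx => ?_⟩
      rw [← hmin c hc] at hx₀
      exact hx₀.2 x hx.2
    · intro xs hxs c hc
      rw [← hmin c ((le_max_left _ _).trans hc)] at hxs
      rw [← hinf c ((le_max_right _ _).trans hc), sInf_image_eq_of_mem_minimizersOn hxs]
  · rintro ⟨lam, ⟨⟨c₁, hc₁, hpen⟩, c₂, hc₂, R, hR, hnd⟩, hloc, c₃, hc₃, hval⟩
    refine ⟨lam, ?_⟩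
    have hprop : ProperSpace X := FiniteDimensional.proper ℝ X
    let cseq : ℕ → ℝ := fun n => max c₁ c₂ + n
    have hge : ∀ n, max c₁ c₂ ≤ cseq n := fun n => le_add_of_nonneg_right n.cast_nonneg
    have hmono : StrictMono cseq := fun a b hab => by
      have : (a : ℝ) < b := by exact_mod_cast hab
      simpa [cseq] using this
    have htend : Tendsto cseq atTop atTop :=
      tendsto_atTop_add_const_left _ _ tendsto_natCast_atTop_atTop
    choose xseq hxmin hxR using fun n => hnd (cseq n) ((le_max_right _ _).trans (hge n))
    obtain ⟨x₀, -, hcl⟩ := (isCompact_closedBall (0 : X) R).exists_mapClusterPt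
      (f := atTop) (u := xseq) (tendsto_principal.2 (Eventually.of_forall fun n => by simpa using hxR n))
    have hx₀ := hpen cseq hmono (fun n => (le_max_left _ _).trans (hge n)) htend xseq hxmin x₀ hcl
    obtain ⟨c₄, -, U, hU, hle⟩ := hloc x₀ hx₀
    obtain ⟨n, hn, hn₃, hn₄⟩ := ((hcl.frequently hU).and_eventually
      ((htend.eventually_ge_atTop c₃).and (htend.eventually_ge_atTop c₄))).exists
    have hx₀min : x₀ ∈ minimizersOn (fun x => F x lam (cseq n)) A :=
      ⟨hx₀.1.2, fun y hy => (hle _ hn₄ _ ⟨hn, (hxmin n).1⟩).trans ((hxmin n).2 y hy)⟩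
    exact hkey lam (cseq n) (hc₃.trans_le hn₃) ⟨x₀, hx₀, hx₀min⟩
      ((sInf_image_eq_of_mem_minimizersOn hx₀min).trans (hval x₀ hx₀ _ hn₃))
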